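/- Let X be a Markov chain on [0,∞) with transition kernel K ∈ D(G), let γ be a uniform extremal boundary for K, let m ≥ 1, and let u_t = u(t) be a nonnegative function with u_t → u > 0 as t → ∞. Define E'_m(t) = (γ(t),∞]^{m-1} × [0,∞], the sub-probability measures μ̃_m^{(t)}(u_t, B) = P_{tu_t}[(X_1/t, …, X_m/t) ∈ B ∩ E'_m(t)], and μ_m(u, B) = P_u[(T*_1, …, T*_m) ∈ B, T*_1 > 0, …, T*_{m-1} > 0]. Then ∫ f dμ̃_m^{(t)}(u_t,·) → ∫ f dμ_m(u,·) as t → ∞ for every continuous function f : [0,∞]^m → [0,∞), i.e., μ̃_m^{(t)}(u_t, ·) converges vaguely to μ_m(u, ·) in M_+([0,∞]^m). -/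

import Mathlib

open MeasureTheory ProbabilityTheory Filter Topology
open scoped NNReal ENNReal

noncomputable section

/-- `K ∈ D(G)`: the transition kernel `K` is in the domain of attraction of `G`, i.e.
`K(t, t·)` converges weakly to `G` on the compactified half-line `[0,∞]` as `t → ∞`. -/
def KernelDOA (K : Kernel ℝ≥0 ℝ≥0) (G : Measure ℝ≥0) : Prop :=
  ∀ f : C(ℝ≥0∞, ℝ),
    Tendsto (fun t : ℝ≥0 => ∫ x, f ((x / t : ℝ≥0) : ℝ≥0∞) ∂(K t))
      atTop (𝓝 (∫ x, f (x : ℝ≥0∞) ∂G))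

/-- A uniform extremal boundary for `K` (relative to `G`): `γ(t) → 0` and
`K(t u_t, t[0,γ(t)]) → G({0})` for every nonnegative `u_t → u > 0`. -/
def UniformExtremalBoundary (K : Kernel ℝ≥0 ℝ≥0) (G : Measure ℝ≥0)
    (γ : ℝ≥0 → ℝ≥0) : Prop :=
  Tendsto γ atTop (𝓝 0) ∧
    ∀ (u : ℝ≥0) (ut : ℝ≥0 → ℝ≥0), 0 < u → Tendsto ut atTop (𝓝 u) →
      Tendsto (fun t : ℝ≥0 => (K (t * ut t)) (Set.Iic (t * γ t))) atTop (𝓝 (G {0}))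

/-- The law of `(X_1, …, X_m)` for the Markov chain with transition kernel `K`
started from `X_0 = y`. -/
def jointLaw (K : Kernel ℝ≥0 ℝ≥0) : (m : ℕ) → ℝ≥0 → Measure (Fin m → ℝ≥0)
  | 0, _ => Measure.dirac (fun i => i.elim0)
  | m + 1, y => (K y).bind (fun x1 => (jointLaw K m x1).map (Fin.cons x1))

/-- The law of `(T*_1, …, T*_m)` for the tail chain associated with `(G, δ_0)`
started from `T*_0 = u`: `T*_n = u ξ_1 ⋯ ξ_n` with `ξ_i` i.i.d. of law `G`. -/
def tailChainLaw (G : Measure ℝ≥0) [IsProbabilityMeasure G] (m : ℕ) (u : ℝ≥0) :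
    Measure (Fin m → ℝ≥0) :=
  (Measure.pi fun _ : Fin m => G).map
    (fun ξ (i : Fin m) => u * ∏ j ∈ Finset.Iic i, ξ j)

/-- The cone `E'_m = (0,∞]^{m-1} × [0,∞]`. -/
def Eprime (m : ℕ) : Set (Fin m → ℝ≥0∞) :=
  {x | ∀ i : Fin m, (i : ℕ) + 1 < m → 0 < x i}

/-- The moving cone `E'_m(t) = (γ(t),∞]^{m-1} × [0,∞]`. -/
def EprimeT (m : ℕ) (c : ℝ≥0) : Set (Fin m → ℝ≥0∞) :=
  {x | ∀ i : Fin m, (i : ℕ) + 1 < m → (c : ℝ≥0∞) < x i}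

theorem measurable_finCons (m : ℕ) :
    Measurable fun p : ℝ≥0 × (Fin m → ℝ≥0) => (Fin.cons p.1 p.2 : Fin (m + 1) → ℝ≥0) := by
  refine measurable_pi_iff.2 fun i => ?_
  refine Fin.cases ?_ (fun j => ?_) i
  · simpa using measurable_fst
  · simpa [Function.comp_def] using (measurable_pi_apply j).comp measurable_snd

theorem measurable_finCons_right (m : ℕ) (x : ℝ≥0) :
    Measurable fun z : Fin m → ℝ≥0 => (Fin.cons x z : Fin (m + 1) → ℝ≥0) :=
  (measurable_finCons m).comp measurable_prodMk_left

/-- The kernel sending `x` to the law of `(x, Z)` with `Z` of law `κ x`. -/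
def consKernel {m : ℕ} (κ : Kernel ℝ≥0 (Fin m → ℝ≥0)) : Kernel ℝ≥0 (Fin (m + 1) → ℝ≥0) :=
  (Kernel.id ×ₖ κ).map fun p : ℝ≥0 × (Fin m → ℝ≥0) => (Fin.cons p.1 p.2 : Fin (m + 1) → ℝ≥0)

theorem consKernel_apply {m : ℕ} (κ : Kernel ℝ≥0 (Fin m → ℝ≥0)) [IsMarkovKernel κ] (x : ℝ≥0) :
    consKernel κ x = (κ x).map (Fin.cons x) := by
  rw [consKernel, Kernel.map_apply _ (measurable_finCons m), Kernel.prod_apply, Kernel.id_apply,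
    Measure.dirac_prod, Measure.map_map (measurable_finCons m) measurable_prodMk_left]
  rfl

instance {m : ℕ} (κ : Kernel ℝ≥0 (Fin m → ℝ≥0)) [IsMarkovKernel κ] :
    IsMarkovKernel (consKernel κ) :=
  Kernel.IsMarkovKernel.map _ (measurable_finCons m)

/-- The kernel sending `y` to the law of the first `m` steps of the chain started at `y`. -/
def jointKernel (K : Kernel ℝ≥0 ℝ≥0) : (m : ℕ) → Kernel ℝ≥0 (Fin m → ℝ≥0)
  | 0 => Kernel.const _ (Measure.dirac fun i => i.elim0)
  | m + 1 => consKernel (jointKernel K m) ∘ₖ K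

instance isMarkovKernel_jointKernel (K : Kernel ℝ≥0 ℝ≥0) [IsMarkovKernel K] :
    (m : ℕ) → IsMarkovKernel (jointKernel K m)
  | 0 => by unfold jointKernel; infer_instance
  | m + 1 => by
    have := isMarkovKernel_jointKernel K m
    unfold jointKernel; infer_instance

theorem jointKernel_apply (K : Kernel ℝ≥0 ℝ≥0) [IsMarkovKernel K] (m : ℕ) (y : ℝ≥0) :
    jointKernel K m y = jointLaw K m y := by
  induction m generalizing y with
  | zero => simp [jointKernel, jointLaw]
  | succ m ih =>
    rw [jointKernel, jointLaw, Kernel.comp_apply]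
    congr 1
    ext1 x
    rw [consKernel_apply, ih]

theorem integral_jointKernel_succ (K : Kernel ℝ≥0 ℝ≥0) [IsMarkovKernel K] (m : ℕ) (y : ℝ≥0)
    (F : (Fin (m + 1) → ℝ≥0) → ℝ) (hF : Measurable F) (M : ℝ) (hM : ∀ x, |F x| ≤ M) :
    ∫ x, F x ∂(jointKernel K (m + 1) y)
      = ∫ x, ∫ z, F (Fin.cons x z) ∂(jointKernel K m x) ∂(K y) := by
  rw [jointKernel, Kernel.integral_comp]
  · refine integral_congr_ae (Eventually.of_forall fun x => ?_)
    simp only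
    rw [consKernel_apply, integral_map (measurable_finCons_right m x).aemeasurable
      hF.aestronglyMeasurable]
  · exact Integrable.of_bound hF.aestronglyMeasurable M (Eventually.of_forall hM)

/-- The kernel sending `u` to the law of `u * ξ` with `ξ` of law `G`. -/
def mulKernel (G : Measure ℝ≥0) : Kernel ℝ≥0 ℝ≥0 :=
  (Kernel.id ×ₖ Kernel.const ℝ≥0 G).map fun p : ℝ≥0 × ℝ≥0 => p.1 * p.2

instance (G : Measure ℝ≥0) [IsProbabilityMeasure G] : IsMarkovKernel (mulKernel G) :=
  Kernel.IsMarkovKernel.map _ measurable_mul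

theorem mulKernel_apply (G : Measure ℝ≥0) [IsProbabilityMeasure G] (u : ℝ≥0) :
    mulKernel G u = G.map (u * ·) := by
  rw [mulKernel, Kernel.map_apply _ measurable_mul, Kernel.prod_apply, Kernel.id_apply,
    Kernel.const_apply, Measure.dirac_prod, Measure.map_map measurable_mul measurable_prodMk_left]
  rfl

theorem prod_Iic_eq_prod_ite {n : ℕ} (x : Fin n → ℝ≥0) (i : Fin n) :
    ∏ j ∈ Finset.Iic i, x j = ∏ j, if j ≤ i then x j else 1 := by
  rw [← Finset.prod_filter]
  congr 1
  ext j
  simp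

theorem cons_mul_prod_Iic {m : ℕ} (u a : ℝ≥0) (ξ : Fin m → ℝ≥0) :
    (fun i : Fin (m + 1) => u * ∏ j ∈ Finset.Iic i, (Fin.cons a ξ : Fin (m + 1) → ℝ≥0) j)
      = Fin.cons (u * a) fun i : Fin m => u * a * ∏ j ∈ Finset.Iic i, ξ j := by
  ext1 i
  rw [prod_Iic_eq_prod_ite, Fin.prod_univ_succ]
  refine Fin.cases ?_ (fun k => ?_) i
  · simp
  · simp [prod_Iic_eq_prod_ite, Fin.succ_le_succ_iff, mul_assoc]

theorem tailChainLaw_eq_jointKernel (G : Measure ℝ≥0) [IsProbabilityMeasure G] (m : ℕ)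
    (u : ℝ≥0) : tailChainLaw G m u = jointKernel (mulKernel G) m u := by
  have hmeas : ∀ (n : ℕ) (v : ℝ≥0),
      Measurable fun (ξ : Fin n → ℝ≥0) (i : Fin n) => v * ∏ j ∈ Finset.Iic i, ξ j := by
    intro n v
    fun_prop
  induction m generalizing u with
  | zero =>
    rw [tailChainLaw, Measure.pi_of_empty _ (fun i => i.elim0), Measure.map_dirac' (hmeas _ _)]
    simp only [jointKernel, Kernel.const_apply]
    congr 1
    exact Subsingleton.elim _ _
  | succ m ih =>
    refine Measure.ext_of_lintegral _ fun F hF => ?_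
    have hmp := (measurePreserving_piFinSuccAbove (fun _ : Fin (m + 1) => G) 0).symm
    have hFu : Measurable fun ξ : Fin (m + 1) → ℝ≥0 => F fun i => u * ∏ j ∈ Finset.Iic i, ξ j :=
      hF.comp (hmeas _ u)
    rw [tailChainLaw, lintegral_map hF (hmeas _ _), ← hmp.lintegral_comp hFu,
      lintegral_prod (fun p : ℝ≥0 × (Fin m → ℝ≥0) => F fun i => u * ∏ j ∈ Finset.Iic i,
        (MeasurableEquiv.piFinSuccAbove (fun _ : Fin (m + 1) => ℝ≥0) 0).symm p j)
        (hFu.comp hmp.measurable).aemeasurable,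
      jointKernel, Kernel.lintegral_comp _ _ _ hF, mulKernel_apply,
      lintegral_map hF.lintegral_kernel (measurable_const_mul u)]
    refine lintegral_congr fun a => ?_
    rw [consKernel_apply, lintegral_map hF (measurable_finCons_right m _), ← ih, tailChainLaw,
      lintegral_map (f := fun z => F (Fin.cons (u * a) z))
        (hF.comp (measurable_finCons_right m _)) (hmeas _ _)]
    refine lintegral_congr fun ξ => ?_
    rw [← cons_mul_prod_Iic]
    simp [MeasurableEquiv.piFinSuccAbove_symm_apply, Fin.insertNthEquiv]

theorem tendsto_prod_nhds_of_forall_path {α : Type*} {F : ℝ≥0 → ℝ≥0 → α} {l : Filter α} {u : ℝ≥0}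
    (h : ∀ ut : ℝ≥0 → ℝ≥0, Tendsto ut atTop (𝓝 u) → Tendsto (fun t => F t (ut t)) atTop l) :
    Tendsto (fun p : ℝ≥0 × ℝ≥0 => F p.1 p.2) (atTop ×ˢ 𝓝 u) l := by
  intro V hV
  by_contra hcon
  obtain ⟨s, hs, hsV⟩ := exists_seq_forall_of_frequently
    (p := fun q : ℝ≥0 × ℝ≥0 => ¬ F q.1 q.2 ∈ V) (l := atTop ×ˢ 𝓝 u) (not_eventually.1 hcon)
  obtain ⟨hs₁, hs₂⟩ := tendsto_prod_iff'.1 hs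
  obtain ⟨φ, hφ, hmono⟩ := strictMono_subseq_of_tendsto_atTop hs₁
  let time : ℕ → ℝ≥0 := fun n => (s (φ n)).1
  let pos : ℕ → ℝ≥0 := fun n => (s (φ n)).2
  let path : ℝ≥0 → ℝ≥0 := Function.extend time pos fun _ => u
  have htime : StrictMono time := hmono
  have hpath : ∀ n, path (time n) = pos n := fun n => htime.injective.extend_apply _ _ _
  have hlim : Tendsto path atTop (𝓝 u) := by
    intro U hU
    obtain ⟨N, hN⟩ := eventually_atTop.1 ((hs₂.comp hφ.tendsto_atTop) hU)
    refine mem_map.2 (mem_atTop_sets.2 ⟨time N, fun t ht => ?_⟩)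
    by_cases hex : ∃ n, time n = t
    · obtain ⟨n, rfl⟩ := hex
      have := hN n (htime.le_iff_le.1 ht)
      rw [Set.mem_preimage, hpath]
      exact this
    · rw [Set.mem_preimage, show path t = u from Function.extend_apply' _ _ _ hex]
      exact mem_of_mem_nhds hU
  obtain ⟨n, hn⟩ := (((h path hlim).comp (hs₁.comp hφ.tendsto_atTop)).eventually_mem hV).exists
  refine hsV (φ n) ?_
  have : F (time n) (path (time n)) ∈ V := hn
  rwa [hpath] at this

theorem continuousOn_of_tendsto_prod {ι : Type*} {p : Filter ι} [p.NeBot] {h : ι → ℝ≥0 → ℝ}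
    {g : ℝ≥0 → ℝ} {s : Set ℝ≥0} (hs : IsOpen s)
    (hlim : ∀ x ∈ s, Tendsto (fun q : ι × ℝ≥0 => h q.1 q.2) (p ×ˢ 𝓝 x) (𝓝 (g x))) :
    ContinuousOn g s := by
  intro x hx
  refine ContinuousAt.continuousWithinAt ?_
  refine (closed_nhds_basis (g x)).tendsto_right_iff.2 fun V hV => ?_
  have h₁ : ∀ᶠ y in 𝓝 x, ∀ᶠ i in p, h i y ∈ V :=
    (((hlim x hx).comp (tendsto_snd.prodMk tendsto_fst)).eventually_mem hV.1).curry
  filter_upwards [h₁, hs.mem_nhds hx] with y hy hys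
  have h₂ : Tendsto (fun i => h i y) p (𝓝 (g y)) :=
    (hlim y hys).comp (tendsto_id.prodMk tendsto_const_nhds)
  exact hV.2.mem_of_tendsto h₂ hy

theorem tendstoUniformlyOn_of_tendsto_prod {ι : Type*} {p : Filter ι} [p.NeBot] {h : ι → ℝ≥0 → ℝ}
    {g : ℝ≥0 → ℝ} {s C : Set ℝ≥0} (hs : IsOpen s) (hC : IsCompact C) (hCs : C ⊆ s)
    (hlim : ∀ x ∈ s, Tendsto (fun q : ι × ℝ≥0 => h q.1 q.2) (p ×ˢ 𝓝 x) (𝓝 (g x))) :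
    TendstoUniformlyOn h g p C := by
  rw [← tendstoLocallyUniformlyOn_iff_tendstoUniformlyOn_of_compact hC]
  refine TendstoLocallyUniformlyOn.mono ?_ hCs
  rw [hs.tendstoLocallyUniformlyOn_iff_forall_tendsto]
  intro x hx
  have hg : Tendsto (fun q : ι × ℝ≥0 => g q.2) (p ×ˢ 𝓝 x) (𝓝 (g x)) :=
    ((continuousOn_of_tendsto_prod hs hlim).continuousAt (hs.mem_nhds hx)).tendsto.comp tendsto_snd
  exact (hg.prodMk_nhds (hlim x hx)).mono_right (nhds_le_uniformity (g x))

/-- A continuous cutoff on `[0,∞]`, supported in `[1/n, n]`, tending to `1` on `(0,∞)`. -/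
def cutoff (n : ℕ) (x : ℝ≥0∞) : ℝ :=
  (min (min ((n : ℝ≥0∞) * x - 1) ((n : ℝ≥0∞) * x⁻¹ - 1)) 1).toReal

theorem continuous_cutoff (n : ℕ) : Continuous (cutoff n) := by
  have h₁ : Continuous fun x : ℝ≥0∞ => (n : ℝ≥0∞) * x - 1 :=
    (ENNReal.continuous_sub_right 1).comp (ENNReal.continuous_const_mul (ENNReal.natCast_ne_top n))
  have h₂ : Continuous fun x : ℝ≥0∞ => (n : ℝ≥0∞) * x⁻¹ - 1 := h₁.comp continuous_inv
  have h₃ := (h₁.min h₂).min (continuous_const : Continuous fun _ : ℝ≥0∞ => (1 : ℝ≥0∞))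
  refine continuous_iff_continuousAt.2 fun x => ?_
  refine (ENNReal.continuousAt_toReal ?_).comp h₃.continuousAt
  exact ne_top_of_le_ne_top ENNReal.one_ne_top (min_le_right _ _)

theorem cutoff_nonneg (n : ℕ) (x : ℝ≥0∞) : 0 ≤ cutoff n x := ENNReal.toReal_nonneg

theorem cutoff_le_one (n : ℕ) (x : ℝ≥0∞) : cutoff n x ≤ 1 :=
  ENNReal.toReal_le_of_le_ofReal zero_le_one (by simp)

theorem cutoff_eq_zero_of_mul_le {n : ℕ} {x : ℝ≥0∞} (h : (n : ℝ≥0∞) * x ≤ 1) :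
    cutoff n x = 0 := by
  simp [cutoff, tsub_eq_zero_of_le h]

theorem cutoff_eq_zero_of_mul_inv_le {n : ℕ} {x : ℝ≥0∞} (h : (n : ℝ≥0∞) * x⁻¹ ≤ 1) :
    cutoff n x = 0 := by
  simp [cutoff, tsub_eq_zero_of_le h]

theorem cutoff_eq_zero_of_notMem_Icc {n : ℕ} (hn : 0 < n) {x : ℝ≥0}
    (hx : x ∉ Set.Icc (n : ℝ≥0)⁻¹ n) : cutoff n (x : ℝ≥0∞) = 0 := by
  have hn' : (0 : ℝ≥0) < n := by exact_mod_cast hn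
  rw [Set.mem_Icc, not_and_or, not_le, not_le] at hx
  rcases hx with hx | hx
  · refine cutoff_eq_zero_of_mul_le ?_
    have : (n : ℝ≥0) * x ≤ 1 := by
      simpa [hn'.ne'] using mul_le_mul_right hx.le (n : ℝ≥0)
    exact_mod_cast this
  · refine cutoff_eq_zero_of_mul_inv_le ?_
    have hx0 : 0 < x := hn'.trans hx
    have : (n : ℝ≥0) * x⁻¹ ≤ 1 := by
      rw [← div_eq_mul_inv]
      exact div_le_one_of_le₀ hx.le hx0.le
    rw [← ENNReal.coe_inv hx0.ne']
    exact_mod_cast this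

theorem tendsto_cutoff {x : ℝ≥0} (hx : 0 < x) :
    Tendsto (fun n => cutoff n (x : ℝ≥0∞)) atTop (𝓝 1) := by
  have key : ∀ y : ℝ≥0∞, y ≠ 0 → ∀ᶠ n : ℕ in atTop, 1 ≤ (n : ℝ≥0∞) * y - 1 := by
    intro y hy
    have h := ENNReal.Tendsto.mul_const ENNReal.tendsto_nat_nhds_top (b := y)
      (Or.inl ENNReal.top_ne_zero)
    rw [ENNReal.top_mul hy] at h
    filter_upwards [h.eventually_const_le (show (2 : ℝ≥0∞) < ⊤ by simp)] with n hn
    refine ENNReal.le_sub_of_add_le_right ENNReal.one_ne_top ?_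
    rwa [one_add_one_eq_two]
  refine tendsto_const_nhds.congr' ?_
  filter_upwards [key x (by simpa using hx.ne'), key (x : ℝ≥0∞)⁻¹ (by simp)] with n h₁ h₂
  simp [cutoff, min_eq_right (le_min h₁ h₂)]

theorem continuous_cutoff_mul (n : ℕ) {g : ℝ≥0 → ℝ} (hg : ContinuousOn g (Set.Ioi 0)) :
    Continuous fun x : ℝ≥0∞ => cutoff n x * g x.toNNReal := by
  refine continuous_iff_continuousAt.2 fun x => ?_
  have hzero : ∀ V : Set ℝ≥0∞, IsOpen V → x ∈ V → (∀ y ∈ V, cutoff n y = 0) →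
      ContinuousAt (fun x : ℝ≥0∞ => cutoff n x * g x.toNNReal) x := by
    intro V hV hxV hc
    refine (continuousAt_const (y := (0 : ℝ))).congr ?_
    filter_upwards [hV.mem_nhds hxV] with y hy
    rw [hc y hy, zero_mul]
  have h₁ : Continuous fun x : ℝ≥0∞ => (n : ℝ≥0∞) * x :=
    ENNReal.continuous_const_mul (ENNReal.natCast_ne_top n)
  rcases eq_or_ne x 0 with rfl | h0
  · exact hzero {y | (n : ℝ≥0∞) * y < 1} (isOpen_lt h₁ continuous_const) (by simp)
      fun y hy => cutoff_eq_zero_of_mul_le (le_of_lt hy)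
  rcases eq_or_ne x ⊤ with rfl | htop
  · exact hzero {y | (n : ℝ≥0∞) * y⁻¹ < 1} (isOpen_lt (h₁.comp continuous_inv) continuous_const)
      (by simp) fun y hy => cutoff_eq_zero_of_mul_inv_le (le_of_lt hy)
  · refine (continuous_cutoff n).continuousAt.mul ?_
    refine ContinuousAt.comp (f := ENNReal.toNNReal) ?_ (ENNReal.tendsto_toNNReal htop)
    exact hg.continuousAt (Ioi_mem_nhds (ENNReal.toNNReal_pos h0 htop))

theorem abs_setIntegral_sub_integral_cutoff_le {μ : Measure ℝ≥0} [IsProbabilityMeasure μ] {n : ℕ}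
    {c : ℝ≥0} (hc : (n : ℝ≥0∞) * c ≤ 1) {h : ℝ≥0 → ℝ} {M : ℝ}
    (hm : AEStronglyMeasurable h (μ.restrict (Set.Ioi c))) (hM : ∀ x ∈ Set.Ioi c, |h x| ≤ M) :
    |∫ x in Set.Ioi c, h x ∂μ - ∫ x, cutoff n (x : ℝ≥0∞) * h x ∂μ|
      ≤ M * (μ.real (Set.Ioi c) - ∫ x, cutoff n (x : ℝ≥0∞) ∂μ) := by
  have hφ : Continuous fun x : ℝ≥0 => cutoff n (x : ℝ≥0∞) :=
    (continuous_cutoff n).comp ENNReal.continuous_coe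
  have hzero : ∀ x : ℝ≥0, x ∉ Set.Ioi c → cutoff n (x : ℝ≥0∞) = 0 := by
    intro x hx
    refine cutoff_eq_zero_of_mul_le (le_trans ?_ hc)
    gcongr
    exact not_lt.1 hx
  have hbound : ∀ᵐ x ∂μ.restrict (Set.Ioi c), |h x| ≤ M :=
    (ae_restrict_iff' measurableSet_Ioi).2 (Eventually.of_forall hM)
  have ih : Integrable h (μ.restrict (Set.Ioi c)) := Integrable.of_bound hm M hbound
  have iφ : Integrable (fun x : ℝ≥0 => cutoff n (x : ℝ≥0∞)) (μ.restrict (Set.Ioi c)) :=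
    Integrable.of_bound hφ.aestronglyMeasurable 1 (Eventually.of_forall fun x => by
      rw [Real.norm_of_nonneg (cutoff_nonneg _ _)]; exact cutoff_le_one _ _)
  have iφh : Integrable (fun x : ℝ≥0 => cutoff n (x : ℝ≥0∞) * h x) (μ.restrict (Set.Ioi c)) := by
    refine Integrable.of_bound (hφ.aestronglyMeasurable.mul hm) M ?_
    filter_upwards [hbound] with x hx
    rw [norm_mul, Real.norm_of_nonneg (cutoff_nonneg _ _)]
    exact (mul_le_of_le_one_left (norm_nonneg _) (cutoff_le_one _ _)).trans hx
  have e₁ : ∫ x, cutoff n (x : ℝ≥0∞) * h x ∂μ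
      = ∫ x in Set.Ioi c, cutoff n (x : ℝ≥0∞) * h x ∂μ :=
    (setIntegral_eq_integral_of_forall_compl_eq_zero fun x hx => by
      rw [hzero x hx, zero_mul]).symm
  have e₂ : ∫ x, cutoff n (x : ℝ≥0∞) ∂μ = ∫ x in Set.Ioi c, cutoff n (x : ℝ≥0∞) ∂μ :=
    (setIntegral_eq_integral_of_forall_compl_eq_zero hzero).symm
  have e₃ : μ.real (Set.Ioi c) = ∫ _ in Set.Ioi c, (1 : ℝ) ∂μ := by simp
  rw [e₁, e₂, e₃, ← integral_sub ih iφh, ← integral_sub (integrable_const (1 : ℝ)) iφ,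
    ← integral_const_mul]
  refine norm_integral_le_of_norm_le (f := fun x => h x - cutoff n (x : ℝ≥0∞) * h x)
    (((integrable_const (1 : ℝ)).sub iφ).const_mul M) ?_
  filter_upwards [hbound] with x hx
  have h1 : h x - cutoff n (x : ℝ≥0∞) * h x = h x * (1 - cutoff n (x : ℝ≥0∞)) := by ring
  have h2 : 0 ≤ 1 - cutoff n (x : ℝ≥0∞) := sub_nonneg.2 (cutoff_le_one _ _)
  rw [h1, norm_mul, Real.norm_of_nonneg h2]
  exact mul_le_mul_of_nonneg_right hx h2

/-- If the probability measures `ν i` converge weakly on `[0,∞]` to `μ`, the boundaries `c i → 0`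
capture the mass of `μ` at `0`, and the bounded functions `h i` converge continuously to `g` on
`(0,∞)`, then the integrals of `h i` beyond the boundary converge. -/
theorem tendsto_setIntegral_of_moving_boundary {ι : Type*} {p : Filter ι} [p.NeBot]
    {ν : ι → Measure ℝ≥0} [∀ i, IsProbabilityMeasure (ν i)] {μ : Measure ℝ≥0}
    [IsProbabilityMeasure μ] {c : ι → ℝ≥0} {h : ι → ℝ≥0 → ℝ} {g : ℝ≥0 → ℝ} {M : ℝ}
    (hweak : ∀ f : C(ℝ≥0∞, ℝ),
      Tendsto (fun i => ∫ x, f (x : ℝ≥0∞) ∂(ν i)) p (𝓝 (∫ x, f (x : ℝ≥0∞) ∂μ)))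
    (hc : Tendsto c p (𝓝 0)) (hmass : Tendsto (fun i => ν i (Set.Iic (c i))) p (𝓝 (μ {0})))
    (hmeas : ∀ i, Measurable (h i)) (hM : ∀ i x, |h i x| ≤ M)
    (hlim : ∀ x ∈ Set.Ioi (0 : ℝ≥0),
      Tendsto (fun q : ι × ℝ≥0 => h q.1 q.2) (p ×ˢ 𝓝 x) (𝓝 (g x))) :
    Tendsto (fun i => ∫ x in Set.Ioi (c i), h i x ∂(ν i)) p
      (𝓝 (∫ x in Set.Ioi 0, g x ∂μ)) := by
  have hgc : ContinuousOn g (Set.Ioi 0) := continuousOn_of_tendsto_prod isOpen_Ioi hlim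
  have hgm : AEStronglyMeasurable g (μ.restrict (Set.Ioi 0)) :=
    hgc.aestronglyMeasurable measurableSet_Ioi
  have hgM : ∀ x ∈ Set.Ioi (0 : ℝ≥0), |g x| ≤ M := fun x hx =>
    le_of_tendsto ((hlim x hx).comp (tendsto_id.prodMk tendsto_const_nhds)).abs
      (Eventually.of_forall fun i => hM i x)
  have hrealIoi : ∀ (ρ : Measure ℝ≥0) [IsProbabilityMeasure ρ] (a : ℝ≥0),
      ρ.real (Set.Ioi a) = 1 - ρ.real (Set.Iic a) := by
    intro ρ _ a
    rw [← Set.compl_Iic, probReal_compl_eq_one_sub measurableSet_Iic]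
  have hIoi : Tendsto (fun i => (ν i).real (Set.Ioi (c i))) p (𝓝 (μ.real (Set.Ioi 0))) := by
    simp_rw [hrealIoi]
    refine tendsto_const_nhds.sub ?_
    have hz : Set.Iic (0 : ℝ≥0) = {0} := by ext; simp
    rw [hz]
    exact (ENNReal.tendsto_toReal (measure_ne_top _ _)).comp hmass
  have hcut : Tendsto (fun n => M * (μ.real (Set.Ioi 0) - ∫ x, cutoff n (x : ℝ≥0∞) ∂μ)) atTop
      (𝓝 0) := by
    have hz : ∀ n, ∫ x, cutoff n (x : ℝ≥0∞) ∂μ = ∫ x in Set.Ioi 0, cutoff n (x : ℝ≥0∞) ∂μ :=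
      fun n => (setIntegral_eq_integral_of_forall_compl_eq_zero fun x hx => by
        have : x = 0 := by simpa using hx
        exact cutoff_eq_zero_of_mul_le (by simp [this])).symm
    have hd : Tendsto (fun n => ∫ x in Set.Ioi 0, cutoff n (x : ℝ≥0∞) ∂μ) atTop
        (𝓝 (∫ _ in Set.Ioi 0, (1 : ℝ) ∂μ)) := by
      refine tendsto_integral_of_dominated_convergence (fun _ => 1) (fun n =>
        ((continuous_cutoff n).comp ENNReal.continuous_coe).aestronglyMeasurable)
        (integrable_const _) (fun n => Eventually.of_forall fun x => ?_) ?_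
      · rw [Real.norm_of_nonneg (cutoff_nonneg _ _)]
        exact cutoff_le_one _ _
      · exact (ae_restrict_iff' measurableSet_Ioi).2 (Eventually.of_forall fun x => tendsto_cutoff)
    simp_rw [hz]
    have := (tendsto_const_nhds (x := μ.real (Set.Ioi 0))).sub hd |>.const_mul M
    simpa using this
  refine Metric.tendsto_nhds.2 fun ε hε => ?_
  have hε5 : 0 < ε / 5 := by positivity
  obtain ⟨n, hn, hpos⟩ := ((hcut.eventually_lt_const hε5).and (eventually_gt_atTop 0)).exists
  have s₁ : ∀ᶠ i in p,
      M * ((ν i).real (Set.Ioi (c i)) - ∫ x, cutoff n (x : ℝ≥0∞) ∂(ν i)) < ε / 5 :=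
    ((hIoi.sub (hweak ⟨cutoff n, continuous_cutoff n⟩)).const_mul M).eventually_lt_const hn
  have s₂ : ∀ᶠ i in p, |∫ x, cutoff n (x : ℝ≥0∞) * g x ∂(ν i)
      - ∫ x, cutoff n (x : ℝ≥0∞) * g x ∂μ| < ε / 5 := by
    have := hweak ⟨_, continuous_cutoff_mul n hgc⟩
    simp only [ContinuousMap.coe_mk, ENNReal.toNNReal_coe] at this
    exact Metric.tendsto_nhds.1 this _ hε5
  have s₃ : ∀ᶠ i in p, (n : ℝ≥0∞) * c i ≤ 1 := by
    have h0 : Tendsto (fun i => (n : ℝ≥0∞) * (c i : ℝ≥0∞)) p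
        (𝓝 ((n : ℝ≥0∞) * ((0 : ℝ≥0) : ℝ≥0∞))) :=
      ENNReal.Tendsto.const_mul (ENNReal.tendsto_coe.2 hc) (Or.inr (ENNReal.natCast_ne_top n))
    exact (h0.eventually_lt_const (by simp)).mono fun i => le_of_lt
  have s₄ : ∀ᶠ i in p, ∀ x ∈ Set.Icc (n : ℝ≥0)⁻¹ n, dist (g x) (h i x) < ε / 5 :=
    Metric.tendstoUniformlyOn_iff.1 (tendstoUniformlyOn_of_tendsto_prod isOpen_Ioi
      isCompact_Icc (fun x hx => lt_of_lt_of_le (by positivity) hx.1) hlim) _ hε5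
  filter_upwards [s₁, s₂, s₃, s₄] with i h₁ h₂ h₃ h₄
  have hφ : Continuous fun x : ℝ≥0 => cutoff n (x : ℝ≥0∞) :=
    (continuous_cutoff n).comp ENNReal.continuous_coe
  have t₁ := (abs_setIntegral_sub_integral_cutoff_le (μ := ν i) h₃
    (hmeas i).aestronglyMeasurable fun x _ => hM i x).trans_lt h₁
  have t₂ := (abs_setIntegral_sub_integral_cutoff_le (μ := μ) (n := n) (c := 0) (by simp)
    hgm hgM).trans_lt hn
  have hpt : ∀ x : ℝ≥0, ‖cutoff n (x : ℝ≥0∞) * h i x - cutoff n (x : ℝ≥0∞) * g x‖ ≤ ε / 5 := by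
    intro x
    by_cases hx : x ∈ Set.Icc (n : ℝ≥0)⁻¹ n
    · rw [← mul_sub, norm_mul, Real.norm_of_nonneg (cutoff_nonneg _ _), ← dist_eq_norm, dist_comm]
      exact (mul_le_of_le_one_left dist_nonneg (cutoff_le_one _ _)).trans (h₄ x hx).le
    · rw [cutoff_eq_zero_of_notMem_Icc hpos hx]
      simpa using hε5.le
  have t₃ : |∫ x, cutoff n (x : ℝ≥0∞) * h i x ∂(ν i) - ∫ x, cutoff n (x : ℝ≥0∞) * g x ∂(ν i)|
      ≤ ε / 5 := by
    rw [← integral_sub]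
    · simpa using norm_integral_le_of_norm_le_const (μ := ν i) (Eventually.of_forall hpt)
    · refine Integrable.of_bound (hφ.measurable.mul (hmeas i)).aestronglyMeasurable M
        (Eventually.of_forall fun x => ?_)
      rw [norm_mul, Real.norm_of_nonneg (cutoff_nonneg _ _)]
      exact (mul_le_of_le_one_left (norm_nonneg _) (cutoff_le_one _ _)).trans (hM i x)
    · have hφg : Continuous fun x : ℝ≥0 => cutoff n (x : ℝ≥0∞) * g x := by
        simpa [Function.comp_def] using
          (continuous_cutoff_mul n hgc).comp ENNReal.continuous_coe
      refine Integrable.of_bound hφg.aestronglyMeasurable M (Eventually.of_forall fun x => ?_)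
      rcases eq_zero_or_pos x with rfl | hx
      · rw [cutoff_eq_zero_of_mul_le (by simp), zero_mul, norm_zero]
        exact (abs_nonneg _).trans (hM i 0)
      · rw [norm_mul, Real.norm_of_nonneg (cutoff_nonneg _ _)]
        exact (mul_le_of_le_one_left (norm_nonneg _) (cutoff_le_one _ _)).trans (hgM x hx)
  rw [Real.dist_eq]
  rw [abs_lt] at t₁ t₂ h₂ ⊢
  rw [abs_le] at t₃
  constructor <;> linarith

theorem aestronglyMeasurable_comp_coe (f : C(ℝ≥0∞, ℝ)) (μ : Measure ℝ≥0) :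
    AEStronglyMeasurable (fun x : ℝ≥0 => f (x : ℝ≥0∞)) μ :=
  (f.continuous.comp ENNReal.continuous_coe).aestronglyMeasurable

theorem continuous_finCons (m : ℕ) : Continuous fun p : ℝ≥0∞ × (Fin m → ℝ≥0∞) =>
    (Fin.cons p.1 p.2 : Fin (m + 1) → ℝ≥0∞) := by
  refine continuous_pi fun i => ?_
  refine Fin.cases ?_ (fun j => ?_) i
  · simpa using continuous_fst
  · simpa [Function.comp_def] using (continuous_apply j).comp continuous_snd

theorem tendsto_integral_div {K : Kernel ℝ≥0 ℝ≥0} [IsMarkovKernel K] {G : Measure ℝ≥0}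
    [IsProbabilityMeasure G] (hK : KernelDOA K G) {u : ℝ≥0} (hu : 0 < u) (f : C(ℝ≥0∞, ℝ)) :
    Tendsto (fun q : ℝ≥0 × ℝ≥0 => ∫ x, f ((x / q.1 : ℝ≥0) : ℝ≥0∞) ∂(K (q.1 * q.2)))
      (atTop ×ˢ 𝓝 u) (𝓝 (∫ x, f (x : ℝ≥0∞) ∂(mulKernel G u))) := by
  let S : ℝ≥0 → C(ℝ≥0∞, ℝ) := fun a =>
    ⟨fun x => f (a * x), f.continuous.comp (ENNReal.continuous_const_mul ENNReal.coe_ne_top)⟩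
  have hS : Tendsto S (𝓝 u) (𝓝 (S u)) := by
    rw [ContinuousMap.tendsto_iff_tendstoLocallyUniformly,
      tendstoLocallyUniformly_iff_forall_tendsto]
    intro x
    have h₁ : Tendsto (fun y : ℝ≥0 × ℝ≥0∞ => S y.1 y.2) (𝓝 u ×ˢ 𝓝 x) (𝓝 (f (u * x))) :=
      (f.continuous.tendsto _).comp (ENNReal.Tendsto.mul
        (ENNReal.continuous_coe.continuousAt.tendsto.comp tendsto_fst)
        (Or.inl (by simpa using hu.ne')) tendsto_snd (Or.inr ENNReal.coe_ne_top))
    have h₂ : Tendsto (fun y : ℝ≥0 × ℝ≥0∞ => S u y.2) (𝓝 u ×ˢ 𝓝 x) (𝓝 (f (u * x))) :=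
      ((S u).continuous.tendsto x).comp tendsto_snd
    exact (h₂.prodMk_nhds h₁).mono_right (nhds_le_uniformity _)
  have hprod : Tendsto (fun q : ℝ≥0 × ℝ≥0 => q.1 * q.2) (atTop ×ˢ 𝓝 u) atTop :=
    tendsto_fst.atTop_mul_pos hu tendsto_snd
  have hmain := (hK (S u)).comp hprod
  have hGu : ∫ x, f (x : ℝ≥0∞) ∂(mulKernel G u) = ∫ x, S u (x : ℝ≥0∞) ∂G := by
    rw [mulKernel_apply, integral_map (measurable_const_mul u).aemeasurable
      (aestronglyMeasurable_comp_coe f _)]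
    simp [S]
  rw [hGu]
  have hint : ∀ (s : ℝ≥0) (φ : C(ℝ≥0∞, ℝ)),
      Integrable (fun x : ℝ≥0 => φ ((x / s : ℝ≥0) : ℝ≥0∞)) (K s) := fun s φ =>
    Integrable.of_bound (φ.continuous.measurable.comp
      (ENNReal.continuous_coe.measurable.comp (measurable_id.div_const s))).aestronglyMeasurable
      ‖φ‖ (Eventually.of_forall fun x => φ.norm_coe_le_norm _)
  have hdiff : Tendsto (fun q : ℝ≥0 × ℝ≥0 => ∫ x, f ((x / q.1 : ℝ≥0) : ℝ≥0∞) ∂(K (q.1 * q.2))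
      - ∫ x, S u ((x / (q.1 * q.2) : ℝ≥0) : ℝ≥0∞) ∂(K (q.1 * q.2))) (atTop ×ˢ 𝓝 u) (𝓝 0) := by
    have hn : Tendsto (fun q : ℝ≥0 × ℝ≥0 => ‖S q.2 - S u‖) (atTop ×ˢ 𝓝 u) (𝓝 0) :=
      (tendsto_iff_norm_sub_tendsto_zero.1 hS).comp tendsto_snd
    refine squeeze_zero_norm' ?_ hn
    filter_upwards [tendsto_fst.eventually (eventually_gt_atTop (0 : ℝ≥0)),
      tendsto_snd.eventually (eventually_gt_nhds hu)] with q h₁ h₂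
    have he : ∀ x : ℝ≥0, f ((x / q.1 : ℝ≥0) : ℝ≥0∞)
        = S q.2 ((x / (q.1 * q.2) : ℝ≥0) : ℝ≥0∞) := by
      intro x
      simp only [S, ContinuousMap.coe_mk, ← ENNReal.coe_mul]
      congr 2
      have := h₁.ne'
      have := h₂.ne'
      field_simp
    simp_rw [he]
    rw [← integral_sub (hint _ _) (hint _ _)]
    refine (norm_integral_le_of_norm_le_const (C := ‖S q.2 - S u‖)
      (Eventually.of_forall fun x => (S q.2 - S u).norm_coe_le_norm _)).trans ?_
    simp
  simpa [Function.comp_def] using hdiff.add hmain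

/-- The section `a ↦ f (a, ·)` of a continuous function on `[0,∞]^{m+1}`. -/
def consSection {m : ℕ} (f : C((Fin (m + 1) → ℝ≥0∞), ℝ)) :
    C(ℝ≥0∞, C((Fin m → ℝ≥0∞), ℝ)) :=
  (f.comp ⟨fun p : ℝ≥0∞ × (Fin m → ℝ≥0∞) => (Fin.cons p.1 p.2 : Fin (m + 1) → ℝ≥0∞),
    continuous_finCons m⟩).curry

theorem consSection_apply {m : ℕ} (f : C((Fin (m + 1) → ℝ≥0∞), ℝ)) (a : ℝ≥0∞)
    (z : Fin m → ℝ≥0∞) : consSection f a z = f (Fin.cons a z) := rfl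

theorem norm_consSection_le {m : ℕ} (f : C((Fin (m + 1) → ℝ≥0∞), ℝ)) (a : ℝ≥0∞) :
    ‖consSection f a‖ ≤ ‖f‖ :=
  (ContinuousMap.norm_le _ (norm_nonneg _)).2 fun _ => f.norm_coe_le_norm _

/-- Rescaling by `t`, as a map into `[0,∞]^m`. -/
def rescale (m : ℕ) (t : ℝ≥0) (x : Fin m → ℝ≥0) : Fin m → ℝ≥0∞ :=
  fun i => ((x i / t : ℝ≥0) : ℝ≥0∞)

theorem measurable_rescale (m : ℕ) (t : ℝ≥0) : Measurable (rescale m t) := by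
  unfold rescale
  fun_prop

theorem rescale_cons (m : ℕ) (t a : ℝ≥0) (z : Fin m → ℝ≥0) :
    rescale (m + 1) t (Fin.cons a z) = Fin.cons ((a / t : ℝ≥0) : ℝ≥0∞) (rescale m t z) := by
  ext1 i
  refine Fin.cases ?_ (fun j => ?_) i <;> simp [rescale]

theorem measurableSet_EprimeT (m : ℕ) (c : ℝ≥0) : MeasurableSet (EprimeT m c) := by
  have : EprimeT m c = ⋂ i : Fin m, ⋂ _ : (i : ℕ) + 1 < m, {x | (c : ℝ≥0∞) < x i} := by
    ext x
    simp [EprimeT]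
  rw [this]
  exact MeasurableSet.iInter fun i => MeasurableSet.iInter fun _ =>
    measurableSet_lt measurable_const (measurable_pi_apply i)

theorem cons_mem_EprimeT {m : ℕ} {c : ℝ≥0} {a : ℝ≥0∞} {z : Fin (m + 1) → ℝ≥0∞} :
    (Fin.cons a z : Fin (m + 2) → ℝ≥0∞) ∈ EprimeT (m + 2) c ↔
      (c : ℝ≥0∞) < a ∧ z ∈ EprimeT (m + 1) c := by
  simp [EprimeT, Fin.forall_fin_succ (n := m + 1)]

theorem EprimeT_one (c : ℝ≥0) : EprimeT 1 c = Set.univ := by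
  ext x
  simp [EprimeT]

/-- The integral of `f` over `E'_m(t)`, with boundary `c`, against the law of the first `m` steps
of the chain started at `y` and rescaled by `t`. -/
def coneIntegral (K : Kernel ℝ≥0 ℝ≥0) (m : ℕ) (f : C((Fin m → ℝ≥0∞), ℝ)) (c t y : ℝ≥0) : ℝ :=
  ∫ x, (EprimeT m c).indicator f (rescale m t x) ∂(jointKernel K m y)

theorem measurable_indicator_rescale {m : ℕ} (f : C((Fin m → ℝ≥0∞), ℝ)) (c t : ℝ≥0) :
    Measurable fun x => (EprimeT m c).indicator f (rescale m t x) :=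
  (f.continuous.measurable.indicator (measurableSet_EprimeT m c)).comp (measurable_rescale m t)

theorem norm_indicator_le {m : ℕ} (f : C((Fin m → ℝ≥0∞), ℝ)) (s : Set (Fin m → ℝ≥0∞))
    (x : Fin m → ℝ≥0∞) : ‖s.indicator f x‖ ≤ ‖f‖ :=
  (norm_indicator_le_norm_self _ _).trans (f.norm_coe_le_norm x)

theorem abs_coneIntegral_le (K : Kernel ℝ≥0 ℝ≥0) [IsMarkovKernel K] {m : ℕ}
    (f : C((Fin m → ℝ≥0∞), ℝ)) (c t y : ℝ≥0) : |coneIntegral K m f c t y| ≤ ‖f‖ := by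
  refine (norm_integral_le_of_norm_le_const
    (Eventually.of_forall fun x => norm_indicator_le f _ _)).trans ?_
  simp

theorem coneIntegral_sub (K : Kernel ℝ≥0 ℝ≥0) [IsMarkovKernel K] {m : ℕ}
    (f g : C((Fin m → ℝ≥0∞), ℝ)) (c t y : ℝ≥0) :
    coneIntegral K m (f - g) c t y = coneIntegral K m f c t y - coneIntegral K m g c t y := by
  have hint : ∀ φ : C((Fin m → ℝ≥0∞), ℝ),
      Integrable (fun x => (EprimeT m c).indicator φ (rescale m t x)) (jointKernel K m y) :=
    fun φ => Integrable.of_bound (measurable_indicator_rescale φ c t).aestronglyMeasurable ‖φ‖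
      (Eventually.of_forall fun x => norm_indicator_le φ _ _)
  rw [coneIntegral, coneIntegral, coneIntegral, ← integral_sub (hint f) (hint g)]
  refine integral_congr_ae (Eventually.of_forall fun x => ?_)
  by_cases hx : rescale m t x ∈ EprimeT m c <;> simp [hx]

theorem measurable_coneIntegral_consSection (K : Kernel ℝ≥0 ℝ≥0) [IsMarkovKernel K] {m : ℕ}
    (f : C((Fin (m + 1) → ℝ≥0∞), ℝ)) (c t : ℝ≥0) :
    Measurable fun a : ℝ≥0 => coneIntegral K m (consSection f a) c t (t * a) := by
  have hF : Measurable fun p : ℝ≥0 × (Fin m → ℝ≥0) =>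
      (EprimeT m c).indicator (consSection f p.1) (rescale m t p.2) := by
    have h₁ : Measurable fun p : ℝ≥0 × (Fin m → ℝ≥0) => consSection f p.1 (rescale m t p.2) := by
      have h₂ : Measurable fun p : ℝ≥0∞ × (Fin m → ℝ≥0∞) => f (Fin.cons p.1 p.2) :=
        (f.continuous.comp (continuous_finCons m)).measurable
      exact h₂.comp ((ENNReal.continuous_coe.measurable.comp measurable_fst).prodMk
        ((measurable_rescale m t).comp measurable_snd))
    exact h₁.indicator
      (((measurable_rescale m t).comp measurable_snd) (measurableSet_EprimeT m c))
  exact (StronglyMeasurable.integral_kernel_prod_right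
    (κ := (jointKernel K m).comap (t * ·) (measurable_const_mul t))
    (f := fun a x => (EprimeT m c).indicator (consSection f a) (rescale m t x))
    hF.stronglyMeasurable).measurable

theorem coneIntegral_succ (K : Kernel ℝ≥0 ℝ≥0) [IsMarkovKernel K] {m : ℕ}
    (f : C((Fin (m + 2) → ℝ≥0∞), ℝ)) (c y : ℝ≥0) {t : ℝ≥0} (ht : t ≠ 0) :
    coneIntegral K (m + 2) f c t y
      = ∫ a in Set.Ioi c, coneIntegral K (m + 1) (consSection f a) c t (t * a)
          ∂((K y).map (· / t)) := by
  have hdiv : Measurable fun x : ℝ≥0 => x / t := measurable_id.div_const t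
  rw [← integral_indicator measurableSet_Ioi, integral_map hdiv.aemeasurable
    ((measurable_coneIntegral_consSection K f c t).indicator
      measurableSet_Ioi).aestronglyMeasurable, coneIntegral,
    integral_jointKernel_succ K (m + 1) y _ (measurable_indicator_rescale f c t) ‖f‖
      fun x => norm_indicator_le f _ _]
  refine integral_congr_ae (Eventually.of_forall fun x => ?_)
  classical
  have hx : t * (x / t) = x := mul_div_cancel₀ x ht
  by_cases hc : c < x / t
  · simp only [Set.indicator_of_mem (show x / t ∈ Set.Ioi c from hc), hx, coneIntegral]
    refine integral_congr_ae (Eventually.of_forall fun z => ?_)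
    simp only [rescale_cons, Set.indicator_apply, cons_mem_EprimeT, ENNReal.coe_lt_coe, hc,
      true_and, consSection_apply]
  · simp only [Set.indicator_of_notMem (show x / t ∉ Set.Ioi c from hc), rescale_cons,
      Set.indicator_apply, cons_mem_EprimeT, ENNReal.coe_lt_coe, hc, false_and, if_false,
      integral_zero]

theorem coneIntegral_one (K : Kernel ℝ≥0 ℝ≥0) [IsMarkovKernel K]
    (f : C((Fin 1 → ℝ≥0∞), ℝ)) (c t y : ℝ≥0) :
    coneIntegral K 1 f c t y = ∫ x, f (fun _ => ((x / t : ℝ≥0) : ℝ≥0∞)) ∂(K y) := by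
  rw [coneIntegral, integral_jointKernel_succ K 0 y _ (measurable_indicator_rescale f c t) ‖f‖
      fun x => norm_indicator_le f _ _]
  refine integral_congr_ae (Eventually.of_forall fun x => ?_)
  have : ∀ z : Fin 0 → ℝ≥0, rescale 1 t (Fin.cons x z) = fun _ => ((x / t : ℝ≥0) : ℝ≥0∞) := by
    intro z
    ext1 i
    rw [Subsingleton.elim i 0]
    rfl
  simp [EprimeT_one, this]

theorem tendsto_coneIntegral {K : Kernel ℝ≥0 ℝ≥0} [IsMarkovKernel K] {G : Measure ℝ≥0}
    [IsProbabilityMeasure G] (hK : KernelDOA K G) {γ : ℝ≥0 → ℝ≥0}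
    (hγ : UniformExtremalBoundary K G γ) (m : ℕ) (f : C((Fin (m + 1) → ℝ≥0∞), ℝ)) {u : ℝ≥0}
    (hu : 0 < u) :
    Tendsto (fun q : ℝ≥0 × ℝ≥0 => coneIntegral K (m + 1) f (γ q.1) q.1 (q.1 * q.2))
      (atTop ×ˢ 𝓝 u) (𝓝 (coneIntegral (mulKernel G) (m + 1) f 0 1 u)) := by
  induction m generalizing u with
  | zero =>
    have h := tendsto_integral_div hK hu
      (f.comp ⟨fun (a : ℝ≥0∞) (_ : Fin 1) => a, continuous_pi fun _ => continuous_id⟩)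
    have hlim := coneIntegral_one (mulKernel G) f 0 1 u
    simp only [div_one] at hlim
    rw [hlim]
    exact h.congr fun q => (coneIntegral_one K f _ _ _).symm
  | succ m ih =>
    have hpos : ∀ᶠ q : ℝ≥0 × ℝ≥0 in atTop ×ˢ 𝓝 u, q.1 ≠ 0 :=
      tendsto_fst.eventually (eventually_ne_atTop (0 : ℝ≥0))
    have hdiv : ∀ t : ℝ≥0, Measurable fun x : ℝ≥0 => x / t := fun t => measurable_id.div_const t
    let ν : ℝ≥0 × ℝ≥0 → Measure ℝ≥0 := fun q => (K (q.1 * q.2)).map (· / q.1)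
    have hν : ∀ q, IsProbabilityMeasure (ν q) := fun q =>
      Measure.isProbabilityMeasure_map (hdiv _).aemeasurable
    have hmul : (mulKernel G u).map (· / 1) = mulKernel G u := by simp
    rw [coneIntegral_succ _ _ _ _ one_ne_zero, hmul]
    have hweak : ∀ φ : C(ℝ≥0∞, ℝ), Tendsto (fun q => ∫ x, φ (x : ℝ≥0∞) ∂(ν q)) (atTop ×ˢ 𝓝 u)
        (𝓝 (∫ x, φ (x : ℝ≥0∞) ∂(mulKernel G u))) := by
      intro φ
      refine (tendsto_integral_div hK hu φ).congr fun q => ?_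
      rw [integral_map (hdiv _).aemeasurable (aestronglyMeasurable_comp_coe φ _)]
    have hmass : Tendsto (fun q => ν q (Set.Iic (γ q.1))) (atTop ×ˢ 𝓝 u)
        (𝓝 (mulKernel G u {0})) := by
      have h0 : mulKernel G u {0} = G {0} := by
        rw [mulKernel_apply, Measure.map_apply (measurable_const_mul u) (measurableSet_singleton 0)]
        congr 1
        ext x
        simp [hu.ne']
      rw [h0]
      refine (tendsto_prod_nhds_of_forall_path
        (F := fun t v => K (t * v) (Set.Iic (t * γ t))) fun ut hut => hγ.2 u ut hu hut).congr' ?_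
      filter_upwards [hpos] with q hq
      rw [Measure.map_apply (hdiv _) measurableSet_Iic]
      congr 1
      ext x
      simp [div_le_iff₀' (pos_of_ne_zero hq)]
    refine (tendsto_setIntegral_of_moving_boundary (ν := ν) (μ := mulKernel G u)
      (c := fun q => γ q.1) (M := ‖f‖)
      (h := fun q a => coneIntegral K (m + 1) (consSection f a) (γ q.1) q.1 (q.1 * a))
      (g := fun a => coneIntegral (mulKernel G) (m + 1) (consSection f a) 0 1 (1 * a))
      hweak (hγ.1.comp tendsto_fst) hmass
      (fun q => measurable_coneIntegral_consSection K f _ _)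
      (fun q a => (abs_coneIntegral_le K _ _ _ _).trans (norm_consSection_le f a)) ?_).congr' ?_
    · intro a ha
      rw [one_mul]
      have hmain := (ih (consSection f a) ha).comp
        ((tendsto_fst.comp tendsto_fst).prodMk tendsto_snd :
          Tendsto (fun r : (ℝ≥0 × ℝ≥0) × ℝ≥0 => (r.1.1, r.2)) ((atTop ×ˢ 𝓝 u) ×ˢ 𝓝 a)
            (atTop ×ˢ 𝓝 a))
      have hsec : Tendsto (fun r : (ℝ≥0 × ℝ≥0) × ℝ≥0 => ‖consSection f r.2 - consSection f a‖)
          ((atTop ×ˢ 𝓝 u) ×ˢ 𝓝 a) (𝓝 0) :=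
        (tendsto_iff_norm_sub_tendsto_zero.1 (((consSection f).continuous.comp
          ENNReal.continuous_coe).tendsto a)).comp tendsto_snd
      have hdiff := squeeze_zero_norm (f := fun r : (ℝ≥0 × ℝ≥0) × ℝ≥0 => coneIntegral K (m + 1)
        (consSection f r.2 - consSection f a) (γ r.1.1) r.1.1 (r.1.1 * r.2))
        (fun r => abs_coneIntegral_le K _ _ _ _) hsec
      simpa [coneIntegral_sub, Function.comp_def] using hdiff.add hmain
    · filter_upwards [hpos] with q hq
      rw [coneIntegral_succ _ _ _ _ hq]

theorem setIntegral_map_rescale {m : ℕ} (μ : Measure (Fin m → ℝ≥0)) (f : C((Fin m → ℝ≥0∞), ℝ))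
    (c t : ℝ≥0) :
    ∫ x, f x ∂((μ.map (rescale m t)).restrict (EprimeT m c))
      = ∫ x, (EprimeT m c).indicator f (rescale m t x) ∂μ := by
  rw [← integral_indicator (measurableSet_EprimeT m c),
    integral_map (measurable_rescale m t).aemeasurable
      (f.continuous.measurable.indicator (measurableSet_EprimeT m c)).aestronglyMeasurable]

/-- Conditional on `X_0 = t u_t` with `u_t → u > 0`, the laws of `(X_1/t, …, X_m/t)`
restricted to `E'_m(t) = (γ(t),∞]^{m-1} × [0,∞]` converge vaguely in `M_+([0,∞]^m)` to
the law of the tail chain `(T*_1, …, T*_m)` started from `u` restricted to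
`E'_m = (0,∞]^{m-1} × [0,∞]`. -/
theorem fdd_vague_convergence_moving_boundary (K : Kernel ℝ≥0 ℝ≥0) [IsMarkovKernel K]
    (G : Measure ℝ≥0) [IsProbabilityMeasure G] (hK : KernelDOA K G)
    (γ : ℝ≥0 → ℝ≥0) (hγ : UniformExtremalBoundary K G γ)
    (m : ℕ) (hm : 1 ≤ m)
    (u : ℝ≥0) (hu : 0 < u) (ut : ℝ≥0 → ℝ≥0) (hut : Tendsto ut atTop (𝓝 u))
    (f : C((Fin m → ℝ≥0∞), ℝ)) (hf0 : ∀ x, 0 ≤ f x) :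
    Tendsto (fun t : ℝ≥0 =>
        ∫ x, f x ∂(((jointLaw K m (t * ut t)).map
          (fun x (i : Fin m) => ((x i / t : ℝ≥0) : ℝ≥0∞))).restrict (EprimeT m (γ t))))
      atTop
      (𝓝 (∫ x, f x ∂(((tailChainLaw G m u).map
          (fun x (i : Fin m) => (x i : ℝ≥0∞))).restrict (Eprime m)))) := by
  obtain ⟨n, rfl⟩ : ∃ n, m = n + 1 := ⟨m - 1, by omega⟩
  have h := (tendsto_coneIntegral hK hγ n f hu).comp (tendsto_id.prodMk hut)
  have hE : Eprime (n + 1) = EprimeT (n + 1) 0 := by simp [Eprime, EprimeT]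
  have hcoe : (fun (x : Fin (n + 1) → ℝ≥0) i => (x i : ℝ≥0∞)) = rescale (n + 1) 1 := by
    ext x i
    simp [rescale]
  rw [hE, hcoe, tailChainLaw_eq_jointKernel, setIntegral_map_rescale]
  refine h.congr fun t => ?_
  rw [← jointKernel_apply]
  exact (setIntegral_map_rescale _ f (γ t) t).symm
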